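/- arXiv:1001.2850 — 3 statements merged into one kernel-verified Lean document; each statement's English description precedes it below -/
import Mathlib

section
/- Let ε, μ ∈ (0,1], let h, b : ℝ² → ℝ be smooth with h bounded together with its derivatives, and let v = (V₁,V₂) : ℝ² → ℝ² be smooth with compact support. Then ∫_{ℝ²} (𝔗v)·v = ∫_{ℝ²} h|v|² + μ ∫_{ℝ²} h ( (h/√3) ∇·v - ε(√3/2) ∇b·v )² + (με²/4) ∫_{ℝ²} h (∇b·v)² + μ ∫_{ℝ²} (curl v)². -/
open MeasureTheory

noncomputable section

/-- Partial derivative in the first coordinate direction. -/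
def pd1 (f : ℝ × ℝ → ℝ) (x : ℝ × ℝ) : ℝ := fderiv ℝ f x (1, 0)

/-- Partial derivative in the second coordinate direction. -/
def pd2 (f : ℝ × ℝ → ℝ) (x : ℝ × ℝ) : ℝ := fderiv ℝ f x (0, 1)

/-- Gradient of a scalar function on `ℝ²`. -/
def grad (f : ℝ × ℝ → ℝ) (x : ℝ × ℝ) : ℝ × ℝ := (pd1 f x, pd2 f x)

/-- Euclidean dot product on `ℝ²`. -/
def dot (a b : ℝ × ℝ) : ℝ := a.1 * b.1 + a.2 * b.2

/-- Divergence of a vector field on `ℝ²`. -/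
def divg (W : ℝ × ℝ → ℝ × ℝ) (x : ℝ × ℝ) : ℝ :=
  pd1 (fun y => (W y).1) x + pd2 (fun y => (W y).2) x

/-- Scalar curl of a vector field on `ℝ²`: `curl W = ∂₁W₂ - ∂₂W₁`. -/
def curl (W : ℝ × ℝ → ℝ × ℝ) (x : ℝ × ℝ) : ℝ :=
  pd1 (fun y => (W y).2) x - pd2 (fun y => (W y).1) x

/-- `∇⊥ f = (-∂₂ f, ∂₁ f)`. -/
def gradPerp (f : ℝ × ℝ → ℝ) (x : ℝ × ℝ) : ℝ × ℝ := (-(pd2 f x), pd1 f x)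

/-- The Green–Naghdi operator `𝒯[h, εb]`. -/
def Tcal (ε : ℝ) (h b : ℝ × ℝ → ℝ) (W : ℝ × ℝ → ℝ × ℝ) (x : ℝ × ℝ) : ℝ × ℝ :=
  (-(1/3 : ℝ)) • grad (fun y => (h y)^3 * divg W y) x
    + (ε/2) • (grad (fun y => (h y)^2 * dot (grad b y) (W y)) x
        - ((h x)^2 * divg W x) • grad b x)
    + (ε^2 * h x * dot (grad b x) (W x)) • grad b x

/-- The operator `𝔗 = h + μ(𝒯[h,εb] - ∇⊥ curl)`. -/
def Tfrak (ε μ : ℝ) (h b : ℝ × ℝ → ℝ) (W : ℝ × ℝ → ℝ × ℝ) (x : ℝ × ℝ) : ℝ × ℝ :=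
  h x • W x + μ • (Tcal ε h b W x - gradPerp (curl W) x)
section DifferentialOperators

variable {f g : ℝ × ℝ → ℝ} {x : ℝ × ℝ}

lemma pd1_mul (hf : DifferentiableAt ℝ f x) (hg : DifferentiableAt ℝ g x) :
    pd1 (fun y => f y * g y) x = pd1 f x * g x + f x * pd1 g x := by
  simp only [pd1, fderiv_fun_mul hf hg, add_apply,
    smul_apply, smul_eq_mul]
  ring

lemma pd2_mul (hf : DifferentiableAt ℝ f x) (hg : DifferentiableAt ℝ g x) :
    pd2 (fun y => f y * g y) x = pd2 f x * g x + f x * pd2 g x := by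
  simp only [pd2, fderiv_fun_mul hf hg, add_apply,
    smul_apply, smul_eq_mul]
  ring

lemma pd1_add (hf : DifferentiableAt ℝ f x) (hg : DifferentiableAt ℝ g x) :
    pd1 (fun y => f y + g y) x = pd1 f x + pd1 g x := by
  simp only [pd1, fderiv_fun_add hf hg, add_apply]

lemma pd2_add (hf : DifferentiableAt ℝ f x) (hg : DifferentiableAt ℝ g x) :
    pd2 (fun y => f y + g y) x = pd2 f x + pd2 g x := by
  simp only [pd2, fderiv_fun_add hf hg, add_apply]

lemma pd1_sub (hf : DifferentiableAt ℝ f x) (hg : DifferentiableAt ℝ g x) :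
    pd1 (fun y => f y - g y) x = pd1 f x - pd1 g x := by
  simp only [pd1, fderiv_fun_sub hf hg, sub_apply]

lemma pd1_const_mul (c : ℝ) (hf : DifferentiableAt ℝ f x) :
    pd1 (fun y => c * f y) x = c * pd1 f x := by
  simp only [pd1, fderiv_const_mul hf, smul_apply, smul_eq_mul]

lemma pd2_const_mul (c : ℝ) (hf : DifferentiableAt ℝ f x) :
    pd2 (fun y => c * f y) x = c * pd2 f x := by
  simp only [pd2, fderiv_const_mul hf, smul_apply, smul_eq_mul]

lemma contDiff_pd1 (hf : ContDiff ℝ (⊤ : ℕ∞) f) : ContDiff ℝ (⊤ : ℕ∞) (pd1 f) :=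
  (hf.fderiv_right (by simp)).clm_apply contDiff_const

lemma contDiff_pd2 (hf : ContDiff ℝ (⊤ : ℕ∞) f) : ContDiff ℝ (⊤ : ℕ∞) (pd2 f) :=
  (hf.fderiv_right (by simp)).clm_apply contDiff_const

variable {W : ℝ × ℝ → ℝ × ℝ}

lemma contDiff_divg (hW : ContDiff ℝ (⊤ : ℕ∞) W) : ContDiff ℝ (⊤ : ℕ∞) (divg W) :=
  (contDiff_pd1 hW.fst).add (contDiff_pd2 hW.snd)

lemma contDiff_curl (hW : ContDiff ℝ (⊤ : ℕ∞) W) : ContDiff ℝ (⊤ : ℕ∞) (curl W) :=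
  (contDiff_pd1 hW.snd).sub (contDiff_pd2 hW.fst)

lemma contDiff_dot_grad (hf : ContDiff ℝ (⊤ : ℕ∞) f) (hW : ContDiff ℝ (⊤ : ℕ∞) W) :
    ContDiff ℝ (⊤ : ℕ∞) (fun y => dot (grad f y) (W y)) :=
  ((contDiff_pd1 hf).mul hW.fst).add ((contDiff_pd2 hf).mul hW.snd)

lemma hasCompactSupport_pd1 (hf : HasCompactSupport f) : HasCompactSupport (pd1 f) :=
  hf.fderiv_apply ℝ _

lemma hasCompactSupport_pd2 (hf : HasCompactSupport f) : HasCompactSupport (pd2 f) :=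
  hf.fderiv_apply ℝ _

lemma hasCompactSupport_divg (hW : HasCompactSupport W) : HasCompactSupport (divg W) :=
  (hasCompactSupport_pd1 (hW.comp_left (g := Prod.fst) rfl)).add
    (hasCompactSupport_pd2 (hW.comp_left (g := Prod.snd) rfl))

lemma hasCompactSupport_curl (hW : HasCompactSupport W) : HasCompactSupport (curl W) :=
  (hasCompactSupport_pd1 (hW.comp_left (g := Prod.snd) rfl)).sub
    (hasCompactSupport_pd2 (hW.comp_left (g := Prod.fst) rfl))

lemma hasCompactSupport_dot (F : ℝ × ℝ → ℝ × ℝ) (hW : HasCompactSupport W) :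
    HasCompactSupport (fun y => dot (F y) (W y)) :=
  hW.mono fun y hy h0 => hy (by simp [dot, h0])

lemma integral_fderiv_apply_eq_zero (hf : ContDiff ℝ (⊤ : ℕ∞) f) (hfs : HasCompactSupport f)
    (u : ℝ × ℝ) : ∫ x, fderiv ℝ f x u = 0 := by
  have hc : Continuous fun x => fderiv ℝ f x u :=
    (hf.continuous_fderiv (by simp)).clm_apply continuous_const
  have := integral_mul_fderiv_eq_neg_fderiv_mul_of_integrable (μ := volume) (v := u)
    (f := fun _ : ℝ × ℝ => (1 : ℝ)) (g := f) (by simp)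
    (by simpa using hc.integrable_of_hasCompactSupport (hfs.fderiv_apply ℝ u))
    (by simpa using hf.continuous.integrable_of_hasCompactSupport hfs)
    (by fun_prop) (fun x _ => hf.differentiable (by simp) x)
  simpa using this

lemma integral_divg_eq_zero (hW : ContDiff ℝ (⊤ : ℕ∞) W) (hWs : HasCompactSupport W) :
    ∫ x, divg W x = 0 := by
  have h1 : HasCompactSupport fun y => (W y).1 := hWs.comp_left (g := Prod.fst) rfl
  have h2 : HasCompactSupport fun y => (W y).2 := hWs.comp_left (g := Prod.snd) rfl
  simp only [divg]
  rw [integral_add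
    ((contDiff_pd1 hW.fst).continuous.integrable_of_hasCompactSupport (hasCompactSupport_pd1 h1))
    ((contDiff_pd2 hW.snd).continuous.integrable_of_hasCompactSupport (hasCompactSupport_pd2 h2))]
  simp only [pd1, pd2]
  rw [integral_fderiv_apply_eq_zero hW.fst h1, integral_fderiv_apply_eq_zero hW.snd h2, add_zero]

end DifferentialOperators

/-- The vector field whose divergence is the difference between the two quadratic integrands. -/
def TfrakFlux (ε μ : ℝ) (h b : ℝ × ℝ → ℝ) (W : ℝ × ℝ → ℝ × ℝ) (x : ℝ × ℝ) : ℝ × ℝ :=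
  (μ * ((-(1/3) * (h x ^ 3 * divg W x) + ε / 2 * (h x ^ 2 * dot (grad b x) (W x))) * (W x).1
      - curl W x * (W x).2),
    μ * ((-(1/3) * (h x ^ 3 * divg W x) + ε / 2 * (h x ^ 2 * dot (grad b x) (W x))) * (W x).2
      + curl W x * (W x).1))

section Flux

variable {h b : ℝ × ℝ → ℝ} {W : ℝ × ℝ → ℝ × ℝ}

lemma contDiff_TfrakFlux (ε μ : ℝ) (hh : ContDiff ℝ (⊤ : ℕ∞) h) (hb : ContDiff ℝ (⊤ : ℕ∞) b)
    (hW : ContDiff ℝ (⊤ : ℕ∞) W) : ContDiff ℝ (⊤ : ℕ∞) (TfrakFlux ε μ h b W) := by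
  have hd := contDiff_divg hW
  have hc := contDiff_curl hW
  have hg := contDiff_dot_grad hb hW
  unfold TfrakFlux
  fun_prop

lemma hasCompactSupport_TfrakFlux (ε μ : ℝ) (h b : ℝ × ℝ → ℝ) (hW : HasCompactSupport W) :
    HasCompactSupport (TfrakFlux ε μ h b W) :=
  hW.mono fun y hy h0 => hy (by simp [TfrakFlux, h0])

lemma dot_Tfrak_eq (ε μ : ℝ) (hh : ContDiff ℝ (⊤ : ℕ∞) h) (hb : ContDiff ℝ (⊤ : ℕ∞) b)
    (hW : ContDiff ℝ (⊤ : ℕ∞) W) (x : ℝ × ℝ) :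
    dot (Tfrak ε μ h b W x) (W x)
      = h x * dot (W x) (W x)
        + μ * (h x * (h x / Real.sqrt 3 * divg W x
              - ε * (Real.sqrt 3 / 2) * dot (grad b x) (W x))^2)
        + μ * ε^2 / 4 * (h x * (dot (grad b x) (W x))^2)
        + μ * (curl W x)^2
        + divg (TfrakFlux ε μ h b W) x := by
  have hd := contDiff_divg hW
  have hA : DifferentiableAt ℝ (fun y => h y ^ 3 * divg W y) x :=
    ((hh.pow 3).mul hd).differentiable (by simp) x
  have hB : DifferentiableAt ℝ (fun y => h y ^ 2 * dot (grad b y) (W y)) x :=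
    ((hh.pow 2).mul (contDiff_dot_grad hb hW)).differentiable (by simp) x
  have hc : DifferentiableAt ℝ (curl W) x := (contDiff_curl hW).differentiable (by simp) x
  have h1 : DifferentiableAt ℝ (fun y => (W y).1) x := hW.fst.differentiable (by simp) x
  have h2 : DifferentiableAt ℝ (fun y => (W y).2) x := hW.snd.differentiable (by simp) x
  have hA' := hA.const_mul (-(1/3 : ℝ))
  have hB' := hB.const_mul (ε / 2)
  have hΦ := hA'.fun_add hB'
  have e1 : pd1 (fun y => (TfrakFlux ε μ h b W y).1) x = _ :=
    (pd1_const_mul μ ((hΦ.fun_mul h1).fun_sub (hc.fun_mul h2)))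
  have e2 : pd2 (fun y => (TfrakFlux ε μ h b W y).2) x = _ :=
    (pd2_const_mul μ ((hΦ.fun_mul h2).fun_add (hc.fun_mul h1)))
  rw [pd1_sub (hΦ.fun_mul h1) (hc.fun_mul h2), pd1_mul hΦ h1, pd1_mul hc h2, pd1_add hA' hB',
    pd1_const_mul _ hA, pd1_const_mul _ hB] at e1
  rw [pd2_add (hΦ.fun_mul h2) (hc.fun_mul h1), pd2_mul hΦ h2, pd2_mul hc h1, pd2_add hA' hB',
    pd2_const_mul _ hA, pd2_const_mul _ hB] at e2
  have hsq : (h x / Real.sqrt 3 * divg W x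
      - ε * (Real.sqrt 3 / 2) * dot (grad b x) (W x)) ^ 2
      = h x ^ 2 / 3 * divg W x ^ 2 - ε * h x * divg W x * dot (grad b x) (W x)
        + ε ^ 2 * (3 / 4) * dot (grad b x) (W x) ^ 2 := by
    have h3 : Real.sqrt 3 ≠ 0 := by positivity
    have h3' : Real.sqrt 3 ^ 2 = 3 := Real.sq_sqrt (by norm_num)
    field_simp
    simp only [h3']
    ring
  have hdiv : divg W x = pd1 (fun y => (W y).1) x + pd2 (fun y => (W y).2) x := rfl
  have hcurl : curl W x = pd1 (fun y => (W y).2) x - pd2 (fun y => (W y).1) x := rfl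
  rw [hsq, divg.eq_1 (TfrakFlux ε μ h b W), e1, e2]
  simp only [Tfrak, Tcal, gradPerp, dot, grad, Prod.fst_add, Prod.snd_add, Prod.fst_sub,
    Prod.snd_sub, Prod.smul_fst, Prod.smul_snd, smul_eq_mul]
  linear_combination
    μ * (-(1/3) * (h x ^ 3 * divg W x)
      + ε / 2 * (h x ^ 2 * (pd1 b x * (W x).1 + pd2 b x * (W x).2))) * hdiv
    - μ * curl W x * hcurl

end Flux

/-- The quadratic-form identity for `𝔗` from the proof of Lemma 2. -/
theorem Tfrak_quadratic_identity (ε μ : ℝ) (hε : ε ∈ Set.Ioc (0:ℝ) 1)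
    (hμ : μ ∈ Set.Ioc (0:ℝ) 1)
    (h b : ℝ × ℝ → ℝ) (hh : ContDiff ℝ (⊤ : ℕ∞) h) (hb : ContDiff ℝ (⊤ : ℕ∞) b)
    (hhbd : ∀ n : ℕ, ∃ C : ℝ, ∀ x, ‖iteratedFDeriv ℝ n h x‖ ≤ C)
    (v : ℝ × ℝ → ℝ × ℝ) (hv : ContDiff ℝ (⊤ : ℕ∞) v) (hvs : HasCompactSupport v) :
    ∫ x : ℝ × ℝ, dot (Tfrak ε μ h b v x) (v x)
      = (∫ x : ℝ × ℝ, h x * dot (v x) (v x))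
        + μ * (∫ x : ℝ × ℝ,
            h x * (h x / Real.sqrt 3 * divg v x
              - ε * (Real.sqrt 3 / 2) * dot (grad b x) (v x))^2)
        + μ * ε^2 / 4 * (∫ x : ℝ × ℝ, h x * (dot (grad b x) (v x))^2)
        + μ * ∫ x : ℝ × ℝ, (curl v x)^2 := by
  have hd := (contDiff_divg hv).continuous
  have hc := (contDiff_curl hv).continuous
  have hg := (contDiff_dot_grad hb hv).continuous
  have hh' := hh.continuous
  have hv' := hv.continuous
  have i1 : Integrable fun x => h x * dot (v x) (v x) :=
    Continuous.integrable_of_hasCompactSupport (by unfold dot; fun_prop)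
      (hasCompactSupport_dot v hvs).mul_left
  have i2 : Integrable fun x => h x * (h x / Real.sqrt 3 * divg v x
      - ε * (Real.sqrt 3 / 2) * dot (grad b x) (v x))^2 := by
    refine Continuous.integrable_of_hasCompactSupport (by fun_prop) (HasCompactSupport.mul_left ?_)
    exact ((hasCompactSupport_divg hvs).mul_left.sub
      (hasCompactSupport_dot (grad b) hvs).mul_left).comp_left (g := fun t : ℝ => t ^ 2) (by simp)
  have i3 : Integrable fun x => h x * (dot (grad b x) (v x))^2 :=
    Continuous.integrable_of_hasCompactSupport (by fun_prop) <| HasCompactSupport.mul_left <|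
      (hasCompactSupport_dot (grad b) hvs).comp_left (g := fun t : ℝ => t ^ 2) (by simp)
  have i4 : Integrable fun x => (curl v x)^2 :=
    Continuous.integrable_of_hasCompactSupport (by fun_prop) <|
      (hasCompactSupport_curl hvs).comp_left (g := fun t : ℝ => t ^ 2) (by simp)
  have hF := contDiff_TfrakFlux ε μ hh hb hv
  have hFs := hasCompactSupport_TfrakFlux ε μ h b hvs
  have i5 : Integrable (divg (TfrakFlux ε μ h b v)) :=
    (contDiff_divg hF).continuous.integrable_of_hasCompactSupport (hasCompactSupport_divg hFs)
  have i12 := i1.fun_add (i2.const_mul μ)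
  have i123 := i12.fun_add (i3.const_mul (μ * ε^2 / 4))
  have i1234 := i123.fun_add (i4.const_mul μ)
  simp only [dot_Tfrak_eq ε μ hh hb hv]
  rw [integral_add i1234 i5, integral_add i123 (i4.const_mul μ),
    integral_add i12 (i3.const_mul _), integral_add i1 (i2.const_mul μ), integral_const_mul,
    integral_const_mul, integral_const_mul, integral_divg_eq_zero hF hFs, add_zero]


end
end

section
/- Let ε, μ ∈ (0,1] and let h, b : ℝ² → ℝ be smooth with h bounded together with its derivatives. For all smooth compactly supported vector fields u, v : ℝ² → ℝ², one has ∫_{ℝ²} (𝔗u)·v = ∫_{ℝ²} u·(𝔗v); that is, the operator 𝔗 is symmetric with respect to the L² inner product. -/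
open MeasureTheory

noncomputable section

theorem ContDiff.pd1 {f : ℝ × ℝ → ℝ} (hf : ContDiff ℝ (⊤ : ℕ∞) f) :
    ContDiff ℝ (⊤ : ℕ∞) (_root_.pd1 f) :=
  (hf.fderiv_right (m := (⊤ : ℕ∞)) (by simp)).clm_apply contDiff_const

theorem ContDiff.pd2 {f : ℝ × ℝ → ℝ} (hf : ContDiff ℝ (⊤ : ℕ∞) f) :
    ContDiff ℝ (⊤ : ℕ∞) (_root_.pd2 f) :=
  (hf.fderiv_right (m := (⊤ : ℕ∞)) (by simp)).clm_apply contDiff_const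

theorem ContDiff.grad {f : ℝ × ℝ → ℝ} (hf : ContDiff ℝ (⊤ : ℕ∞) f) :
    ContDiff ℝ (⊤ : ℕ∞) (_root_.grad f) :=
  hf.pd1.prodMk hf.pd2

theorem ContDiff.gradPerp {f : ℝ × ℝ → ℝ} (hf : ContDiff ℝ (⊤ : ℕ∞) f) :
    ContDiff ℝ (⊤ : ℕ∞) (_root_.gradPerp f) :=
  hf.pd2.neg.prodMk hf.pd1

theorem ContDiff.dot {U V : ℝ × ℝ → ℝ × ℝ} (hU : ContDiff ℝ (⊤ : ℕ∞) U)
    (hV : ContDiff ℝ (⊤ : ℕ∞) V) : ContDiff ℝ (⊤ : ℕ∞) (fun x => _root_.dot (U x) (V x)) :=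
  (hU.fst.mul hV.fst).add (hU.snd.mul hV.snd)

theorem ContDiff.divg {W : ℝ × ℝ → ℝ × ℝ} (hW : ContDiff ℝ (⊤ : ℕ∞) W) :
    ContDiff ℝ (⊤ : ℕ∞) (_root_.divg W) :=
  hW.fst.pd1.add hW.snd.pd2

theorem ContDiff.curl {W : ℝ × ℝ → ℝ × ℝ} (hW : ContDiff ℝ (⊤ : ℕ∞) W) :
    ContDiff ℝ (⊤ : ℕ∞) (_root_.curl W) :=
  hW.snd.pd1.sub hW.fst.pd2

theorem ContDiff.Tcal {h b : ℝ × ℝ → ℝ} {W : ℝ × ℝ → ℝ × ℝ} (ε : ℝ)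
    (hh : ContDiff ℝ (⊤ : ℕ∞) h) (hb : ContDiff ℝ (⊤ : ℕ∞) b)
    (hW : ContDiff ℝ (⊤ : ℕ∞) W) : ContDiff ℝ (⊤ : ℕ∞) (_root_.Tcal ε h b W) :=
  ((((hh.pow 3).mul hW.divg).grad.const_smul _).add
    ((((hh.pow 2).mul (hb.grad.dot hW)).grad.sub
      (((hh.pow 2).mul hW.divg).smul hb.grad)).const_smul _)).add
    (((contDiff_const.mul hh).mul (hb.grad.dot hW)).smul hb.grad)

theorem ContDiff.Tfrak {h b : ℝ × ℝ → ℝ} {W : ℝ × ℝ → ℝ × ℝ} (ε μ : ℝ)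
    (hh : ContDiff ℝ (⊤ : ℕ∞) h) (hb : ContDiff ℝ (⊤ : ℕ∞) b)
    (hW : ContDiff ℝ (⊤ : ℕ∞) W) : ContDiff ℝ (⊤ : ℕ∞) (_root_.Tfrak ε μ h b W) :=
  (hh.smul hW).add (((ContDiff.Tcal ε hh hb hW).sub hW.curl.gradPerp).const_smul _)

theorem integrable_fderiv_apply {g : ℝ × ℝ → ℝ} (hg : ContDiff ℝ 1 g)
    (hgs : HasCompactSupport g) (w : ℝ × ℝ) : Integrable (fun x => fderiv ℝ g x w) :=
  ((hg.continuous_fderiv (by simp)).clm_apply continuous_const).integrable_of_hasCompactSupport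
    (hgs.fderiv_apply ℝ w)

theorem integral_fderiv_apply_eq_zero_s3 {g : ℝ × ℝ → ℝ} (hg : ContDiff ℝ 1 g)
    (hgs : HasCompactSupport g) (w : ℝ × ℝ) : ∫ x, fderiv ℝ g x w = 0 := by
  have key := integral_mul_fderiv_eq_neg_fderiv_mul_of_integrable (μ := volume)
    (f := fun _ : ℝ × ℝ => (1 : ℝ)) (g := g) (v := w) (by simp)
    (by simpa using integrable_fderiv_apply hg hgs w)
    (by simpa using hg.continuous.integrable_of_hasCompactSupport hgs)
    (fun x _ => differentiableAt_const _)
    (fun x _ => (hg.differentiable (by simp)) x)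
  simpa using key

theorem fderiv_mul_apply {f g : ℝ × ℝ → ℝ} {x : ℝ × ℝ} (hf : DifferentiableAt ℝ f x)
    (hg : DifferentiableAt ℝ g x) (w : ℝ × ℝ) :
    fderiv ℝ (fun y => f y * g y) x w = f x * fderiv ℝ g x w + fderiv ℝ f x w * g x := by
  rw [fderiv_fun_mul hf hg]
  simp [mul_comm]

/-- The symmetric bilinear density associated with `𝔗`. -/
def TfrakForm (ε μ : ℝ) (h b : ℝ × ℝ → ℝ) (u v : ℝ × ℝ → ℝ × ℝ) (x : ℝ × ℝ) : ℝ :=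
  h x * dot (u x) (v x) + μ * ((1/3 : ℝ) * h x ^ 3 * divg u x * divg v x
    - (ε/2) * h x ^ 2 * (dot (grad b x) (u x) * divg v x + divg u x * dot (grad b x) (v x))
    + ε^2 * h x * dot (grad b x) (u x) * dot (grad b x) (v x) + curl u x * curl v x)

theorem TfrakForm_comm (ε μ : ℝ) (h b : ℝ × ℝ → ℝ) (u v : ℝ × ℝ → ℝ × ℝ) (x : ℝ × ℝ) :
    TfrakForm ε μ h b u v x = TfrakForm ε μ h b v u x := by
  simp only [TfrakForm, dot]
  ring

theorem dot_comm (p q : ℝ × ℝ) : dot p q = dot q p := by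
  simp only [dot]
  ring

theorem integral_dot_Tfrak (ε μ : ℝ) {h b : ℝ × ℝ → ℝ} (hh : ContDiff ℝ (⊤ : ℕ∞) h)
    (hb : ContDiff ℝ (⊤ : ℕ∞) b) {u v : ℝ × ℝ → ℝ × ℝ} (hu : ContDiff ℝ (⊤ : ℕ∞) u)
    (hv : ContDiff ℝ (⊤ : ℕ∞) v) (hvs : HasCompactSupport v) :
    ∫ x, dot (Tfrak ε μ h b u x) (v x) = ∫ x, TfrakForm ε μ h b u v x := by
  have hv1 : HasCompactSupport (fun x => (v x).1) := hvs.comp_left (g := Prod.fst) rfl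
  have hv2 : HasCompactSupport (fun x => (v x).2) := hvs.comp_left (g := Prod.snd) rfl
  have hA := (hh.pow 3).mul hu.divg
  have hB := (hh.pow 2).mul (hb.grad.dot hu)
  have hc := hu.curl
  -- the flux whose divergence is the difference of the two integrands
  set P : ℝ × ℝ → ℝ := fun x => -(1/3 : ℝ) * (h x ^ 3 * divg u x)
    + (ε/2) * (h x ^ 2 * dot (grad b x) (u x)) with hPdef
  have hP : ContDiff ℝ (⊤ : ℕ∞) P :=
    (contDiff_const.mul hA).add (contDiff_const.mul hB)
  have le1 : (1 : WithTop ℕ∞) ≤ ((⊤ : ℕ∞) : WithTop ℕ∞) := by exact_mod_cast le_top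
  have diff {f : ℝ × ℝ → ℝ} (hf : ContDiff ℝ (⊤ : ℕ∞) f) (x : ℝ × ℝ) :
      DifferentiableAt ℝ f x := (hf.differentiable (by simp)) x
  have dP (x w : ℝ × ℝ) : fderiv ℝ P x w
      = -(1/3 : ℝ) * fderiv ℝ (fun y => h y ^ 3 * divg u y) x w
        + (ε/2) * fderiv ℝ (fun y => h y ^ 2 * dot (grad b y) (u y)) x w := by
    rw [hPdef, fderiv_fun_add ((diff hA x).const_mul _) ((diff hB x).const_mul _),
      fderiv_const_mul (diff hA x), fderiv_const_mul (diff hB x)]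
    rfl
  have hG1 : ContDiff ℝ 1 (fun x => P x * (v x).1 - curl u x * (v x).2) :=
    ((hP.mul hv.fst).sub (hc.mul hv.snd)).of_le le1
  have hG2 : ContDiff ℝ 1 (fun x => P x * (v x).2 + curl u x * (v x).1) :=
    ((hP.mul hv.snd).add (hc.mul hv.fst)).of_le le1
  have hG1s : HasCompactSupport (fun x => P x * (v x).1 - curl u x * (v x).2) :=
    (hv1.mul_left (f := P)).sub (hv2.mul_left (f := curl u))
  have hG2s : HasCompactSupport (fun x => P x * (v x).2 + curl u x * (v x).1) :=
    (hv2.mul_left (f := P)).add (hv1.mul_left (f := curl u))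
  have hT := ContDiff.Tfrak ε μ hh hb hu
  have hF : Integrable (fun x => dot (Tfrak ε μ h b u x) (v x)) :=
    (hT.dot hv).continuous.integrable_of_hasCompactSupport
      ((hv1.mul_left (f := fun x => (Tfrak ε μ h b u x).1)).add
        (hv2.mul_left (f := fun x => (Tfrak ε μ h b u x).2)))
  have pointwise (x : ℝ × ℝ) : TfrakForm ε μ h b u v x = dot (Tfrak ε μ h b u x) (v x)
      - μ * (fderiv ℝ (fun x => P x * (v x).1 - curl u x * (v x).2) x (1, 0)
        + fderiv ℝ (fun x => P x * (v x).2 + curl u x * (v x).1) x (0, 1)) := by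
    rw [fderiv_fun_sub (diff (hP.mul hv.fst) x) (diff (hc.mul hv.snd) x),
      fderiv_fun_add (diff (hP.mul hv.snd) x) (diff (hc.mul hv.fst) x),
      sub_apply, add_apply,
      fderiv_mul_apply (diff hP x) (diff hv.fst x), fderiv_mul_apply (diff hc x) (diff hv.snd x),
      fderiv_mul_apply (diff hP x) (diff hv.snd x), fderiv_mul_apply (diff hc x) (diff hv.fst x),
      dP, dP, hPdef]
    simp only [TfrakForm, Tfrak, Tcal, dot, grad, gradPerp, Prod.fst_add, Prod.snd_add,
      Prod.fst_sub, Prod.snd_sub, Prod.smul_fst, Prod.smul_snd, smul_eq_mul]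
    have e1 : divg v x = fderiv ℝ (fun y => (v y).1) x (1, 0)
      + fderiv ℝ (fun y => (v y).2) x (0, 1) := rfl
    have e2 : curl v x = fderiv ℝ (fun y => (v y).2) x (1, 0)
      - fderiv ℝ (fun y => (v y).1) x (0, 1) := rfl
    rw [e1, e2]
    generalize divg u = d
    generalize curl u = c
    simp only [pd1, pd2]
    ring
  simp_rw [pointwise]
  have i1 := integrable_fderiv_apply hG1 hG1s (1, 0)
  have i2 := integrable_fderiv_apply hG2 hG2s (0, 1)
  have i3 := (i1.fun_add i2).const_mul μ
  rw [integral_sub hF i3, integral_const_mul, integral_add i1 i2,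
    integral_fderiv_apply_eq_zero_s3 hG1 hG1s, integral_fderiv_apply_eq_zero_s3 hG2 hG2s]
  simp

/-- The operator `𝔗` is symmetric for the `L²` inner product (proof of Lemma 2). -/
theorem Tfrak_symmetric (ε μ : ℝ) (hε : ε ∈ Set.Ioc (0:ℝ) 1)
    (hμ : μ ∈ Set.Ioc (0:ℝ) 1)
    (h b : ℝ × ℝ → ℝ) (hh : ContDiff ℝ (⊤ : ℕ∞) h) (hb : ContDiff ℝ (⊤ : ℕ∞) b)
    (hhbd : ∀ n : ℕ, ∃ C : ℝ, ∀ x, ‖iteratedFDeriv ℝ n h x‖ ≤ C)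
    (u v : ℝ × ℝ → ℝ × ℝ) (hu : ContDiff ℝ (⊤ : ℕ∞) u) (hus : HasCompactSupport u)
    (hv : ContDiff ℝ (⊤ : ℕ∞) v) (hvs : HasCompactSupport v) :
    ∫ x : ℝ × ℝ, dot (Tfrak ε μ h b u x) (v x)
      = ∫ x : ℝ × ℝ, dot (u x) (Tfrak ε μ h b v x) := by
  simp_rw [dot_comm (u _)]
  rw [integral_dot_Tfrak ε μ hh hb hu hv hvs, integral_dot_Tfrak ε μ hh hb hv hu hus]
  simp_rw [TfrakForm_comm ε μ h b u v]

end
end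

section
/- Let ε, β ∈ ℝ and let ζ, b, ψ : ℝ² → ℝ be smooth, with h = 1 + εζ - βb. Define φ₁(X,z) = (z - εζ(X)) ( -(1/2)(z + εζ(X)) - 1 + βb(X) ) Δψ(X) + β (z - εζ(X)) ∇b(X)·∇ψ(X). Then for every X ∈ ℝ², ∫_{-1+βb(X)}^{εζ(X)} ∇_X φ₁(X,z) dz = - 𝒯[h,βb](∇ψ)(X), where 𝒯[h,βb]W = -(1/3)∇(h³ ∇·W) + (β/2)[∇(h² ∇b·W) - h² (∇·W) ∇b] + β² h (∇b·W) ∇b. -/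
open MeasureTheory

noncomputable section

/-- The directional derivatives of a smooth function are smooth. -/
theorem contDiff_fderiv_apply_const {f : ℝ × ℝ → ℝ} (hf : ContDiff ℝ (⊤ : ℕ∞) f) (v : ℝ × ℝ) :
    ContDiff ℝ (⊤ : ℕ∞) (fun x => fderiv ℝ f x v) :=
  (hf.fderiv_right (m := (⊤ : ℕ∞)) (by simp)).clm_apply contDiff_const

/-- Directional derivative of a quadratic profile in `z` that vanishes at `z = ε * ζ`. -/
theorem fderiv_profile_apply (ε β z : ℝ) {ζ b L G : ℝ × ℝ → ℝ} {x : ℝ × ℝ}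
    (hζ : DifferentiableAt ℝ ζ x) (hb : DifferentiableAt ℝ b x)
    (hL : DifferentiableAt ℝ L x) (hG : DifferentiableAt ℝ G x) (v : ℝ × ℝ) :
    fderiv ℝ (fun y => (z - ε * ζ y) * (-(1/2) * (z + ε * ζ y) - 1 + β * b y) * L y
        + β * (z - ε * ζ y) * G y) x v
      = ((1 + ε * ζ x - β * b x) * (ε * fderiv ℝ ζ x v)
            + β * fderiv ℝ b x v * (z - ε * ζ x)) * L x
        + (z - ε * ζ x) * (-(1/2) * (z + ε * ζ x) - 1 + β * b x) * fderiv ℝ L x v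
        - β * (ε * fderiv ℝ ζ x v) * G x + β * (z - ε * ζ x) * fderiv ℝ G x v := by
  have h1 := (hζ.hasFDerivAt.const_mul ε).const_sub z
  have h2 := ((((hζ.hasFDerivAt.const_mul ε).const_add z).const_mul (-(1/2))).sub_const 1).add
    (hb.hasFDerivAt.const_mul β)
  have h := ((h1.mul h2).mul hL.hasFDerivAt).add ((h1.const_mul β).mul hG.hasFDerivAt)
  refine (congrArg (fun A : ℝ × ℝ →L[ℝ] ℝ => A v) h.fderiv).trans ?_
  simp
  ring

/-- Directional derivative of `h ^ n * F` with `h = 1 + ε * ζ - β * b`. -/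
theorem fderiv_depth_pow_mul_apply (ε β : ℝ) (n : ℕ) {ζ b F : ℝ × ℝ → ℝ} {x : ℝ × ℝ}
    (hζ : DifferentiableAt ℝ ζ x) (hb : DifferentiableAt ℝ b x)
    (hF : DifferentiableAt ℝ F x) (v : ℝ × ℝ) :
    fderiv ℝ (fun y => (1 + ε * ζ y - β * b y) ^ n * F y) x v
      = n * (1 + ε * ζ x - β * b x) ^ (n - 1) * (ε * fderiv ℝ ζ x v - β * fderiv ℝ b x v) * F x
        + (1 + ε * ζ x - β * b x) ^ n * fderiv ℝ F x v := by
  have h1 := ((hζ.hasFDerivAt.const_mul ε).const_add 1).sub (hb.hasFDerivAt.const_mul β)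
  have h := (h1.pow n).mul hF.hasFDerivAt
  refine (congrArg (fun A : ℝ × ℝ →L[ℝ] ℝ => A v) h.fderiv).trans ?_
  simp
  ring

/-- The integral over the fluid column of the derivative in `fderiv_profile_apply`. -/
theorem integral_profile_deriv (β a B a' b' L L' G G' : ℝ) :
    ∫ z in (-1 + B)..a, (((1 + a - B) * a' + β * b' * (z - a)) * L
        + (z - a) * (-(1/2) * (z + a) - 1 + B) * L' - β * a' * G + β * (z - a) * G')
      = (1 + a - B) ^ 2 * (a' - β * b' / 2) * L + (1 + a - B) ^ 3 / 3 * L'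
        - β * a' * (1 + a - B) * G - β * (1 + a - B) ^ 2 / 2 * G' := by
  have hderiv : ∀ z : ℝ, HasDerivAt (fun z : ℝ =>
      (1 + a - B) * a' * L * (z - a) + β * b' * L * ((z - a) ^ 2 / 2)
        + L' * (-((z - a) ^ 3 / 6) - (1 + a - B) * ((z - a) ^ 2 / 2))
        - β * a' * G * (z - a) + β * G' * ((z - a) ^ 2 / 2))
      (((1 + a - B) * a' + β * b' * (z - a)) * L
        + (z - a) * (-(1/2) * (z + a) - 1 + B) * L' - β * a' * G + β * (z - a) * G') z := by
    intro z
    have h1 : HasDerivAt (fun z : ℝ => z - a) 1 z := (hasDerivAt_id z).sub_const a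
    have h2 := (h1.pow 2).div_const 2
    have h3 := (h1.pow 3).div_const 6
    have h := ((((h1.const_mul ((1 + a - B) * a' * L)).add (h2.const_mul (β * b' * L))).add
      ((h3.neg.sub (h2.const_mul (1 + a - B))).const_mul L')).sub
      (h1.const_mul (β * a' * G))).add (h2.const_mul (β * G'))
    refine h.congr_deriv ?_
    norm_num
    ring
  rw [intervalIntegral.integral_eq_sub_of_hasDerivAt (fun z _ => hderiv z)
    (Continuous.intervalIntegrable (by fun_prop) _ _)]
  ring

/-- The vertical average of the horizontal gradient of the corrector `φ₁`
equals `-𝒯[h,βb](∇ψ)` (derivation of equation (14)). -/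
theorem integral_grad_phi1 (ε β : ℝ) (ζ b ψ : ℝ × ℝ → ℝ)
    (hζ : ContDiff ℝ (⊤ : ℕ∞) ζ) (hb : ContDiff ℝ (⊤ : ℕ∞) b) (hψ : ContDiff ℝ (⊤ : ℕ∞) ψ)
    (φ₁ : ℝ × ℝ → ℝ → ℝ)
    (hφ₁ : ∀ X z, φ₁ X z
      = (z - ε * ζ X) * (-(1/2) * (z + ε * ζ X) - 1 + β * b X)
          * (pd1 (pd1 ψ) X + pd2 (pd2 ψ) X)
        + β * (z - ε * ζ X) * dot (grad b X) (grad ψ X)) :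
    ∀ X : ℝ × ℝ,
      (∫ z in (-1 + β * b X)..(ε * ζ X), grad (fun Y => φ₁ Y z) X)
        = -(Tcal β (fun Y => 1 + ε * ζ Y - β * b Y) b (fun Y => grad ψ Y) X) := by
  intro X
  have hd : ∀ {f : ℝ × ℝ → ℝ}, ContDiff ℝ (⊤ : ℕ∞) f → DifferentiableAt ℝ f X := fun hf =>
    (hf.differentiable (by simp)).differentiableAt
  have hL : DifferentiableAt ℝ (divg (fun Y => grad ψ Y)) X :=
    hd ((contDiff_fderiv_apply_const (contDiff_fderiv_apply_const hψ _) _).add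
      (contDiff_fderiv_apply_const (contDiff_fderiv_apply_const hψ _) _))
  have hG : DifferentiableAt ℝ (fun Y => dot (grad b Y) (grad ψ Y)) X :=
    hd (((contDiff_fderiv_apply_const hb _).mul (contDiff_fderiv_apply_const hψ _)).add
      ((contDiff_fderiv_apply_const hb _).mul (contDiff_fderiv_apply_const hψ _)))
  have hprof : ∀ (z : ℝ) (v : ℝ × ℝ), fderiv ℝ (fun Y => φ₁ Y z) X v
      = ((1 + ε * ζ X - β * b X) * (ε * fderiv ℝ ζ X v)
            + β * fderiv ℝ b X v * (z - ε * ζ X)) * divg (fun Y => grad ψ Y) X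
        + (z - ε * ζ X) * (-(1/2) * (z + ε * ζ X) - 1 + β * b X)
            * fderiv ℝ (divg (fun Y => grad ψ Y)) X v
        - β * (ε * fderiv ℝ ζ X v) * dot (grad b X) (grad ψ X)
        + β * (z - ε * ζ X) * fderiv ℝ (fun Y => dot (grad b Y) (grad ψ Y)) X v := fun z v => by
    rw [funext fun Y => hφ₁ Y z]
    exact fderiv_profile_apply ε β z (hd hζ) (hd hb) hL hG v
  have hint : IntervalIntegrable (fun z => grad (fun Y => φ₁ Y z) X) volume
      (-1 + β * b X) (ε * ζ X) := by
    apply Continuous.intervalIntegrable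
    simp only [grad, pd1, pd2, hprof]
    fun_prop
  have h3 := fderiv_depth_pow_mul_apply ε β 3 (hd hζ) (hd hb) hL
  have h2 := fderiv_depth_pow_mul_apply ε β 2 (hd hζ) (hd hb) hG
  ext
  · refine ((ContinuousLinearMap.fst ℝ ℝ ℝ).intervalIntegral_comp_comm hint).symm.trans ?_
    have hI : ∫ z in (-1 + β * b X)..(ε * ζ X), fderiv ℝ (fun Y => φ₁ Y z) X (1, 0) = _ :=
      (intervalIntegral.integral_congr fun z _ => hprof z (1, 0)).trans
        (integral_profile_deriv _ _ _ _ _ _ _ _ _)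
    refine hI.trans ?_
    change _ = -(-(1/3) * fderiv ℝ _ X (1, 0) + β / 2 * (fderiv ℝ _ X (1, 0)
      - _ * fderiv ℝ b X (1, 0)) + _ * fderiv ℝ b X (1, 0))
    rw [h3, h2]
    push_cast
    ring
  · refine ((ContinuousLinearMap.snd ℝ ℝ ℝ).intervalIntegral_comp_comm hint).symm.trans ?_
    have hI : ∫ z in (-1 + β * b X)..(ε * ζ X), fderiv ℝ (fun Y => φ₁ Y z) X (0, 1) = _ :=
      (intervalIntegral.integral_congr fun z _ => hprof z (0, 1)).trans
        (integral_profile_deriv _ _ _ _ _ _ _ _ _)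
    refine hI.trans ?_
    change _ = -(-(1/3) * fderiv ℝ _ X (0, 1) + β / 2 * (fderiv ℝ _ X (0, 1)
      - _ * fderiv ℝ b X (0, 1)) + _ * fderiv ℝ b X (0, 1))
    rw [h3, h2]
    push_cast
    ring

end
end
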